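/- For every integer k ≥ 5 and every s ≥ 1, both k + C̃_k(β^s) + C_k(γ^s) ⊆ L(k) and k + C_k(β^s) + C_k(β^s) ⊆ L(k); moreover, for s = 0 (β^0 the empty word), k + C_k(β^0) + C_k(β^0) ⊆ L(k). -/

import Mathlib

open Filter Set
open scoped Pointwise

noncomputable section

/-- The `n`-th convergent of the continued fraction `[0; a 0, a 1, a 2, …]`. -/
def cfConv : ℕ → (ℕ → ℕ) → ℝ
  | 0, _ => 0
  | n + 1, a => 1 / (a 0 + cfConv n fun i => a (i + 1))

/-- The value `[0; a 0, a 1, a 2, …]` of the infinite continued fraction with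
partial quotients `a 0, a 1, …` (the limit of its convergents). -/
def cfVal (a : ℕ → ℕ) : ℝ := limUnder atTop fun n => cfConv n a

/-- The sequence of partial quotients obtained by concatenating the finite word `b`
with the sequence `θ`. -/
def app (b : List ℕ) (θ : ℕ → ℕ) : ℕ → ℕ := fun n =>
  if h : n < b.length then b.get ⟨n, h⟩ else θ (n - b.length)

/-- `λ_i(θ) = [a_i; a_{i+1}, …] + [0; a_{i-1}, a_{i-2}, …]` for a bi-infinite
sequence `θ` of partial quotients. -/
def lamCF (θ : ℤ → ℕ) (i : ℤ) : ℝ :=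
  (θ i : ℝ) + cfVal (fun n => θ (i + 1 + n)) + cfVal (fun n => θ (i - 1 - n))

/-- The classical Lagrange spectrum. -/
def LSpec : Set ℝ :=
  {x | ∃ θ : ℤ → ℕ, (∀ i, 1 ≤ θ i) ∧
    IsBoundedUnder (· ≤ ·) atTop (lamCF θ) ∧ x = limsup (lamCF θ) atTop}

/-- The classical Markov spectrum. -/
def MSpec : Set ℝ :=
  {x | ∃ θ : ℤ → ℕ, (∀ i, 1 ≤ θ i) ∧
    BddAbove (Set.range (lamCF θ)) ∧ x = ⨆ i, lamCF θ i}

/-- The Lagrange spectrum `L(k)` of sequences with partial quotients in `{1, …, k}`. -/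
def LSpecK (k : ℕ) : Set ℝ :=
  {x | ∃ θ : ℤ → ℕ, (∀ i, 1 ≤ θ i ∧ θ i ≤ k) ∧ x = limsup (lamCF θ) atTop}

/-- The Markov spectrum `M(k)` of sequences with partial quotients in `{1, …, k}`. -/
def MSpecK (k : ℕ) : Set ℝ :=
  {x | ∃ θ : ℤ → ℕ, (∀ i, 1 ≤ θ i ∧ θ i ≤ k) ∧ x = ⨆ i, lamCF θ i}

/-- `C_k(w) = {[0; w, θ] : θ_n ∈ {1,…,k-1} for all n}`. -/
def Ck (k : ℕ) (w : List ℕ) : Set ℝ :=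
  {x | ∃ θ : ℕ → ℕ, (∀ n, 1 ≤ θ n ∧ θ n ≤ k - 1) ∧ x = cfVal (app w θ)}

/-- `C̃_k(w)`: those `[0; w, θ]` with `θ_n ∈ {1,…,k-1}` and `(θ_1, θ_2) ≠ (1, k-1)`. -/
def Ctilk (k : ℕ) (w : List ℕ) : Set ℝ :=
  {x | ∃ θ : ℕ → ℕ, (∀ n, 1 ≤ θ n ∧ θ n ≤ k - 1) ∧ (θ 0, θ 1) ≠ (1, k - 1) ∧
    x = cfVal (app w θ)}

/-- The word `β^s = (1,k)_s` (the empty word when `s = 0`). -/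
def betaW (k s : ℕ) : List ℕ := (List.replicate s [1, k]).flatten

/-- The word `γ^s = (1,k)_{s-1}, 1, k-1`. -/
def gammaW (k s : ℕ) : List ℕ := betaW k (s - 1) ++ [1, k - 1]

/-- All terms of the sequence lie in `{1, …, k}`. -/
def Digits (k : ℕ) (a : ℕ → ℕ) : Prop := ∀ n, 1 ≤ a n ∧ a n ≤ k

lemma Digits.mono {k l : ℕ} {a : ℕ → ℕ} (h : Digits k a) (hkl : k ≤ l) : Digits l a :=
  fun n => ⟨(h n).1, (h n).2.trans hkl⟩

lemma Digits.tail {k : ℕ} {a : ℕ → ℕ} (h : Digits k a) : Digits k fun i => a (i + 1) :=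
  fun n => h (n + 1)

lemma cfConv_nonneg (n : ℕ) (a : ℕ → ℕ) : 0 ≤ cfConv n a := by
  induction n generalizing a with
  | zero => simp [cfConv]
  | succ n ih =>
    have := ih fun i => a (i + 1)
    simp only [cfConv]
    positivity

lemma cfConv_le_one {k : ℕ} {a : ℕ → ℕ} (h : Digits k a) (n : ℕ) : cfConv n a ≤ 1 := by
  cases n with
  | zero => simp [cfConv]
  | succ n =>
    have h0 := cfConv_nonneg n fun i => a (i + 1)
    have h1 : (1 : ℝ) ≤ a 0 := by exact_mod_cast (h 0).1
    simp only [cfConv]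
    rw [div_le_one (by linarith)]
    linarith

lemma le_cfConv_succ {k : ℕ} {a : ℕ → ℕ} (h : Digits k a) (n : ℕ) :
    1 / ((k : ℝ) + 1) ≤ cfConv (n + 1) a := by
  have h0 := cfConv_nonneg n fun i => a (i + 1)
  have h1 : (1 : ℝ) ≤ a 0 := by exact_mod_cast (h 0).1
  have h2 : (a 0 : ℝ) ≤ k := by exact_mod_cast (h 0).2
  have h3 := cfConv_le_one h.tail n
  simp only [cfConv]
  exact one_div_le_one_div_of_le (by linarith) (by linarith)

/-- Contraction factor of `x ↦ 1 / (d + x)` on `[1 / (k + 1), 1]`. -/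
def contr (k : ℕ) : ℝ := 1 / (1 + 1 / ((k : ℝ) + 1))

lemma contr_nonneg (k : ℕ) : 0 ≤ contr k := by
  unfold contr; positivity

lemma contr_lt_one (k : ℕ) : contr k < 1 := by
  unfold contr
  have : 0 < 1 / ((k : ℝ) + 1) := by positivity
  rw [div_lt_one (by linarith)]
  linarith

lemma abs_inv_sub_inv_le {k : ℕ} {d x y : ℝ} (hd : 1 ≤ d) (hx : 1 / ((k : ℝ) + 1) ≤ x)
    (hy : 0 ≤ y) : |1 / (d + x) - 1 / (d + y)| ≤ contr k * |x - y| := by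
  have hk : 0 < 1 / ((k : ℝ) + 1) := by positivity
  have e : 1 / (d + x) - 1 / (d + y) = (1 / (d + x)) * (1 / (d + y)) * (y - x) := by
    have : d + x ≠ 0 := by linarith
    have : d + y ≠ 0 := by linarith
    field_simp
    ring
  have h1 : 1 / (d + x) ≤ contr k := one_div_le_one_div_of_le (by linarith) (by linarith)
  have h2 : 1 / (d + y) ≤ 1 := by
    rw [div_le_one (by linarith)]; linarith
  have h3 : 0 ≤ 1 / (d + x) := by apply div_nonneg <;> linarith
  have h4 : 0 ≤ 1 / (d + y) := by apply div_nonneg <;> linarith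
  rw [e, abs_mul, abs_sub_comm y x, abs_of_nonneg (mul_nonneg h3 h4)]
  apply mul_le_mul_of_nonneg_right _ (abs_nonneg _)
  nlinarith [contr_nonneg k]

lemma cfConv_dist {k : ℕ} {a b : ℕ → ℕ} (ha : Digits k a) (hb : Digits k b) (n m m' : ℕ)
    (hab : ∀ i < n, a i = b i) :
    |cfConv (n + (m + 1)) a - cfConv (n + (m' + 1)) b| ≤ contr k ^ n := by
  induction n generalizing a b with
  | zero =>
    simp only [zero_add, pow_zero]
    rw [abs_le]
    constructor <;> linarith [cfConv_nonneg (m + 1) a, cfConv_nonneg (m' + 1) b,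
      cfConv_le_one ha (m + 1), cfConv_le_one hb (m' + 1)]
  | succ n ih =>
    have h := ih ha.tail hb.tail fun i hi => hab (i + 1) (by omega)
    have e : ∀ m, n + 1 + (m + 1) = (n + (m + 1)) + 1 := fun m => by ring
    rw [e, e]
    have h0 : (1 : ℝ) ≤ a 0 := by exact_mod_cast (ha 0).1
    rw [cfConv, cfConv, ← hab 0 (by omega), pow_succ']
    exact (abs_inv_sub_inv_le h0 (le_cfConv_succ ha.tail (n + m)) (cfConv_nonneg _ _)).trans
      (mul_le_mul_of_nonneg_left h (contr_nonneg k))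

lemma tendsto_cfConv {k : ℕ} {a : ℕ → ℕ} (h : Digits k a) :
    Tendsto (fun n => cfConv n a) atTop (nhds (cfVal a)) := by
  have hc : CauchySeq fun n => cfConv n a := by
    rw [Metric.cauchySeq_iff']
    intro ε hε
    obtain ⟨N, hN⟩ := exists_pow_lt_of_lt_one hε (contr_lt_one k)
    refine ⟨N + (0 + 1), fun n hn => ?_⟩
    obtain ⟨m, rfl⟩ : ∃ m, n = N + (m + 1) := ⟨n - N - 1, by omega⟩
    exact (cfConv_dist h h N m 0 fun _ _ => rfl).trans_lt hN
  obtain ⟨l, hl⟩ := cauchySeq_tendsto_of_complete hc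
  unfold cfVal
  rwa [hl.limUnder_eq]

lemma cfVal_nonneg {k : ℕ} {a : ℕ → ℕ} (h : Digits k a) : 0 ≤ cfVal a :=
  ge_of_tendsto' (tendsto_cfConv h) fun n => cfConv_nonneg n a

lemma cfVal_le_one {k : ℕ} {a : ℕ → ℕ} (h : Digits k a) : cfVal a ≤ 1 :=
  le_of_tendsto' (tendsto_cfConv h) fun n => cfConv_le_one h n

lemma cfVal_eq {k : ℕ} {a : ℕ → ℕ} (h : Digits k a) :
    cfVal a = 1 / (a 0 + cfVal fun i => a (i + 1)) := by
  have h1 := (tendsto_cfConv h).comp (tendsto_add_atTop_nat 1)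
  have h0 : (1 : ℝ) ≤ a 0 := by exact_mod_cast (h 0).1
  have h2 : Tendsto (fun n => 1 / ((a 0 : ℝ) + cfConv n fun i => a (i + 1))) atTop
      (nhds (1 / (a 0 + cfVal fun i => a (i + 1)))) :=
    tendsto_const_nhds.div ((tendsto_cfConv h.tail).const_add _)
      (by linarith [cfVal_nonneg h.tail])
  exact tendsto_nhds_unique h1 h2

lemma cfVal_le_inv {k : ℕ} {a : ℕ → ℕ} (h : Digits k a) : cfVal a ≤ 1 / a 0 := by
  have h0 : (1 : ℝ) ≤ a 0 := by exact_mod_cast (h 0).1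
  rw [cfVal_eq h]
  exact one_div_le_one_div_of_le (by linarith) (by linarith [cfVal_nonneg h.tail])

lemma le_cfVal {k : ℕ} {a : ℕ → ℕ} (h : Digits k a) : 1 / ((a 0 : ℝ) + 1) ≤ cfVal a := by
  have h0 : (1 : ℝ) ≤ a 0 := by exact_mod_cast (h 0).1
  rw [cfVal_eq h]
  exact one_div_le_one_div_of_le (by linarith [cfVal_nonneg h.tail])
    (by linarith [cfVal_le_one h.tail])

lemma le_cfVal' {k : ℕ} {a : ℕ → ℕ} (h : Digits k a) : 1 / ((k : ℝ) + 1) ≤ cfVal a := by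
  have h0 : (a 0 : ℝ) ≤ k := by exact_mod_cast (h 0).2
  exact (one_div_le_one_div_of_le (by positivity) (by linarith)).trans (le_cfVal h)

lemma cfVal_dist {k : ℕ} {a b : ℕ → ℕ} (ha : Digits k a) (hb : Digits k b) (n : ℕ)
    (hab : ∀ i < n, a i = b i) : |cfVal a - cfVal b| ≤ contr k ^ n := by
  have h1 := (tendsto_cfConv ha).comp (tendsto_add_atTop_nat (n + 1))
  have h2 := (tendsto_cfConv hb).comp (tendsto_add_atTop_nat (n + 1))
  refine le_of_tendsto' (h1.sub h2).abs fun m => ?_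
  have := cfConv_dist ha hb n m m hab
  simpa [Function.comp, show m + (n + 1) = n + (m + 1) by ring] using this

/-- `lamCF` only depends on the sequence up to translation. -/
lemma lamCF_shift (θ : ℤ → ℕ) (c j : ℤ) : lamCF (fun i => θ (c + i)) j = lamCF θ (c + j) := by
  simp only [lamCF]
  congr 4 <;> funext n <;> congr 1 <;> ring

lemma Digits.right {k : ℕ} {V : ℤ → ℕ} (h : ∀ i, 1 ≤ V i ∧ V i ≤ k) (j : ℤ) :
    Digits k fun n => V (j + 1 + n) := fun _ => h _

lemma Digits.left {k : ℕ} {V : ℤ → ℕ} (h : ∀ i, 1 ≤ V i ∧ V i ≤ k) (j : ℤ) :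
    Digits k fun n => V (j - 1 - n) := fun _ => h _

/-- A limsup equal to `lamCF W 0` is realised by concatenating longer and longer central blocks
of `W`, provided no other position of such a block has a bigger value. -/
lemma lamCF_zero_mem_LSpecK {k : ℕ} {W : ℤ → ℕ} (hW : ∀ i, 1 ≤ W i ∧ W i ≤ k) (M : ℕ)
    (H : ∀ m : ℕ, M ≤ m → ∀ V : ℤ → ℕ, (∀ i, 1 ≤ V i ∧ V i ≤ k) →
      (∀ j : ℤ, -m ≤ j → j ≤ m → V j = W j) →
      ∀ j : ℤ, -m ≤ j → j ≤ m → j ≠ 0 → lamCF V j ≤ max (lamCF W 0) (lamCF V 0)) :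
    lamCF W 0 ∈ LSpecK k := by
  let r : ℤ → ℕ := fun i => Nat.sqrt i.toNat
  let θ : ℤ → ℕ := fun i => W (i - ((r i : ℤ) * r i + r i))
  have hθ : ∀ i, 1 ≤ θ i ∧ θ i ≤ k := fun i => hW _
  have hr : ∀ (m : ℕ) (j : ℤ), -m ≤ j → j ≤ m → r ((m : ℤ) * m + m + j) = m := by
    intro m j h1 h2
    refine Nat.eq_sqrt.mpr ⟨?_, ?_⟩ |>.symm <;> zify <;>
      rw [Int.toNat_of_nonneg (by nlinarith)] <;> linarith
  have hagree : ∀ (m : ℕ) (j : ℤ), -m ≤ j → j ≤ m → θ ((m : ℤ) * m + m + j) = W j := by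
    intro m j h1 h2
    simp only [θ]
    rw [hr m j h1 h2]
    congr 1
    ring
  have hcenter : ∀ m : ℕ, |lamCF θ ((m : ℤ) * m + m) - lamCF W 0| ≤ 2 * contr k ^ m := by
    intro m
    have e := lamCF_shift θ ((m : ℤ) * m + m) 0
    rw [add_zero] at e
    rw [← e]
    have h0 := hagree m 0 (by omega) (by omega)
    have h1 := cfVal_dist (Digits.right (fun i => hθ ((m : ℤ) * m + m + i)) 0)
      (Digits.right hW 0) m fun i hi => hagree m _ (by omega) (by omega)
    have h2 := cfVal_dist (Digits.left (fun i => hθ ((m : ℤ) * m + m + i)) 0)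
      (Digits.left hW 0) m fun i hi => hagree m _ (by omega) (by omega)
    simp only [lamCF, h0]
    rw [abs_le] at h1 h2 ⊢
    constructor <;> linarith [h1.1, h1.2, h2.1, h2.2]
  have hle : ∀ i : ℤ, 0 ≤ i → M ≤ r i → lamCF θ i ≤ lamCF W 0 + 2 * contr k ^ r i := by
    intro i hi hM
    have hp : 0 ≤ contr k ^ r i := pow_nonneg (contr_nonneg k) _
    have hs1 : (r i : ℤ) * r i ≤ i := by
      have := Nat.sqrt_le i.toNat
      zify at this
      rwa [Int.toNat_of_nonneg hi] at this
    have hs2 : i < ((r i : ℤ) + 1) * (r i + 1) := by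
      have := Nat.lt_succ_sqrt i.toNat
      zify at this
      rw [Int.toNat_of_nonneg hi] at this
      exact_mod_cast this
    have hc := abs_le.mp (hcenter (r i))
    obtain ⟨j, hj⟩ : ∃ j : ℤ, i = (r i : ℤ) * r i + r i + j := ⟨i - ((r i : ℤ) * r i + r i),
        by ring⟩
    by_cases hj0 : j = 0
    · subst hj0
      rw [add_zero] at hj
      rw [← hj] at hc
      linarith
    · have := H (r i) hM (fun j => θ ((r i : ℤ) * r i + r i + j)) (fun j => hθ _)
        (fun j h1 h2 => hagree (r i) j h1 h2) j (by linarith) (by linarith) hj0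
      rw [lamCF_shift, lamCF_shift, add_zero, ← hj] at this
      refine this.trans (max_le (by linarith) (by linarith))
  have hub : ∀ i, lamCF θ i ≤ k + 2 := fun i => by
    have h1 := cfVal_le_one (Digits.right hθ i)
    have h2 := cfVal_le_one (Digits.left hθ i)
    have h3 : (θ i : ℝ) ≤ k := by exact_mod_cast (hθ i).2
    simp only [lamCF]
    linarith
  have hlb : ∀ i, 0 ≤ lamCF θ i := fun i => by
    have h1 := cfVal_nonneg (Digits.right hθ i)
    have h2 := cfVal_nonneg (Digits.left hθ i)
    simp only [lamCF]
    positivity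
  have hbdd : IsBoundedUnder (· ≤ ·) atTop (lamCF θ) := isBoundedUnder_of ⟨_, hub⟩
  have hcob : IsCoboundedUnder (· ≤ ·) atTop (lamCF θ) :=
    (isBoundedUnder_of ⟨0, hlb⟩ : IsBoundedUnder (· ≥ ·) atTop (lamCF θ)).isCoboundedUnder_le
  refine ⟨θ, hθ, le_antisymm ?_ ?_⟩
  · refine le_of_forall_pos_le_add fun ε hε => ?_
    obtain ⟨N, hN⟩ := exists_pow_lt_of_lt_one (half_pos hε) (contr_lt_one k)
    rw [← sub_le_iff_le_add]
    refine le_limsup_of_frequently_le (frequently_atTop.mpr fun i => ?_) hbdd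
    refine ⟨((N + i.toNat : ℕ) : ℤ) * (N + i.toNat : ℕ) + (N + i.toNat : ℕ), ?_, ?_⟩
    · have := Int.self_le_toNat i
      push_cast
      nlinarith
    · have := abs_le.mp (hcenter (N + i.toNat))
      have h2 : contr k ^ (N + i.toNat) ≤ contr k ^ N :=
        pow_le_pow_of_le_one (contr_nonneg k) (contr_lt_one k).le (by omega)
      linarith
  · refine le_of_forall_pos_le_add fun ε hε => ?_
    obtain ⟨N, hN⟩ := exists_pow_lt_of_lt_one (half_pos hε) (contr_lt_one k)
    refine limsup_le_of_le hcob ?_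
    filter_upwards [eventually_ge_atTop (((N + M : ℕ) : ℤ) * (N + M : ℕ))] with i hi
    have hi0 : 0 ≤ i := le_trans (by positivity) hi
    have hri : N + M ≤ r i := by
      refine Nat.le_sqrt.mpr ?_
      zify
      rw [Int.toNat_of_nonneg hi0]
      exact_mod_cast hi
    have h2 : contr k ^ r i ≤ contr k ^ N :=
      pow_le_pow_of_le_one (contr_nonneg k) (contr_lt_one k).le (by omega)
    linarith [hle i hi0 (by omega)]

/-- Hall's subdivision argument. `S a b c d` says that `[a, d]` is an admissible interval whose
gap `(b, c)` is to be removed. -/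
lemma exists_near_sum_of_bridges (S : ℝ → ℝ → ℝ → ℝ → Prop) (E : Set ℝ) (C : ℝ)
    (hS : ∀ a b c d, S a b c d → (a ∈ E ∧ d ∈ E) ∧ 0 < c - b ∧ c - b ≤ b - a ∧ c - b ≤ d - c ∧
      d - a ≤ C * (c - b) ∧ (∃ b' c', S a b' c' b ∧ c' - b' ≤ c - b) ∧
      (∃ b' c', S c b' c' d ∧ c' - b' ≤ c - b))
    {ε t : ℝ} (hε : 0 < ε) (N : ℕ) :
    ∀ a b c d a' b' c' d', S a b c d → S a' b' c' d' → c - b ≤ d' - a' → c' - b' ≤ d - a →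
      a + a' ≤ t → t ≤ d + d' → (d - a) + (d' - a') ≤ N * ε →
      ∃ x ∈ E, ∃ y ∈ E, |t - (x + y)| ≤ 2 * |C| * ε := by
  induction N with
  | zero =>
    intro a b c d a' b' c' d' h h' _ _ _ _ hN
    obtain ⟨-, h1, h2, h3, -⟩ := hS _ _ _ _ h
    obtain ⟨-, h1', h2', h3', -⟩ := hS _ _ _ _ h'
    simp only [CharP.cast_eq_zero, zero_mul] at hN
    linarith
  | succ N ih =>
    have key : ∀ a b c d a' b' c' d', S a b c d → S a' b' c' d' → c - b ≤ d' - a' →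
        c' - b' ≤ d - a → a + a' ≤ t → t ≤ d + d' → (d - a) + (d' - a') ≤ (N + 1 : ℕ) * ε →
        c' - b' ≤ c - b → ∃ x ∈ E, ∃ y ∈ E, |t - (x + y)| ≤ 2 * |C| * ε := by
      intro a b c d a' b' c' d' h h' hg hg' hl hr hN hbig
      obtain ⟨hE, h1, h2, h3, h4, ⟨p, q, hp, hpq⟩, ⟨p', q', hp', hpq'⟩⟩ := hS _ _ _ _ h
      obtain ⟨hE', h1', h2', h3', h4', -⟩ := hS _ _ _ _ h'
      rcases le_or_gt (c - b) ε with hs | hs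
      · refine ⟨a, hE.1, a', hE'.1, ?_⟩
        have e1 : C * (c - b) ≤ |C| * ε :=
          (mul_le_mul_of_nonneg_right (le_abs_self C) h1.le).trans
            (mul_le_mul_of_nonneg_left hs (abs_nonneg C))
        have e2 : C * (c' - b') ≤ |C| * ε :=
          (mul_le_mul_of_nonneg_right (le_abs_self C) h1'.le).trans
            (mul_le_mul_of_nonneg_left (hbig.trans hs) (abs_nonneg C))
        rw [abs_le]
        constructor <;> linarith
      · push_cast at hN
        rcases le_total t (b + d') with ht | ht
        · exact ih a p q b a' b' c' d' hp h' (by linarith) (by linarith) hl ht (by linarith)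
        · exact ih c p' q' d a' b' c' d' hp' h' (by linarith) (by linarith) (by linarith) hr
            (by linarith)
    intro a b c d a' b' c' d' h h' hg hg' hl hr hN
    rcases le_total (c' - b') (c - b) with hb | hb
    · exact key a b c d a' b' c' d' h h' hg hg' hl hr hN hb
    · obtain ⟨x, hx, y, hy, hxy⟩ := key a' b' c' d' a b c d h' h hg' hg (by linarith)
        (by linarith) (by linarith) hb
      exact ⟨y, hy, x, hx, by rwa [add_comm y x]⟩

lemma mem_add_of_bridges (S : ℝ → ℝ → ℝ → ℝ → Prop) {E : Set ℝ} (hE : IsCompact E) (C : ℝ)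
    (hS : ∀ a b c d, S a b c d → (a ∈ E ∧ d ∈ E) ∧ 0 < c - b ∧ c - b ≤ b - a ∧ c - b ≤ d - c ∧
      d - a ≤ C * (c - b) ∧ (∃ b' c', S a b' c' b ∧ c' - b' ≤ c - b) ∧
      (∃ b' c', S c b' c' d ∧ c' - b' ≤ c - b))
    {a b c d t : ℝ} (h : S a b c d) (hl : a + a ≤ t) (hr : t ≤ d + d) : t ∈ E + E := by
  rw [← (hE.add hE).isClosed.closure_eq, Metric.mem_closure_iff]
  intro ε hε
  have hpos : 0 < ε / (4 * (|C| + 1)) := by positivity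
  obtain ⟨N, hN⟩ := exists_nat_ge (((d - a) + (d - a)) / (ε / (4 * (|C| + 1))))
  rw [div_le_iff₀ hpos] at hN
  obtain ⟨-, h1, h2, h3, -⟩ := hS _ _ _ _ h
  obtain ⟨x, hx, y, hy, hxy⟩ := exists_near_sum_of_bridges S E C hS hpos N a b c d a b c d h h
    (by linarith) (by linarith) hl hr hN
  refine ⟨x + y, add_mem_add hx hy, hxy.trans_lt ?_⟩
  have : 2 * |C| * (ε / (4 * (|C| + 1))) = (|C| / (|C| + 1)) * (ε / 2) := by
    field_simp
    ring
  rw [this]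
  have : |C| / (|C| + 1) ≤ 1 := by
    rw [div_le_one (by positivity)]; linarith
  nlinarith

/-- Sequences of digits `1, …, 4` in which a digit `1` is never followed by a digit `4`. -/
def Seq14 : Set (ℕ → ℕ) := {θ | Digits 4 θ ∧ ∀ n, θ n = 1 → θ (n + 1) ≠ 4}

/-- Values of the sequences in `Seq14`. -/
def E14 : Set ℝ := cfVal '' Seq14

/-- Values of the sequences in `Seq14` that may follow a digit `1`. -/
def F14 : Set ℝ := cfVal '' {θ | θ ∈ Seq14 ∧ θ 0 ≠ 4}

lemma continuousOn_cfVal (k : ℕ) : ContinuousOn cfVal {θ | Digits k θ} := by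
  intro θ hθ
  rw [ContinuousWithinAt, Metric.tendsto_nhds]
  intro ε hε
  obtain ⟨N, hN⟩ := exists_pow_lt_of_lt_one hε (contr_lt_one k)
  have h : ∀ᶠ θ' in nhds θ, ∀ i ∈ Finset.range N, θ' i = θ i := by
    rw [Filter.eventually_all_finset]
    intro i _
    have hc : Continuous fun θ' : ℕ → ℕ => θ' i := continuous_apply i
    exact (hc.tendsto θ).eventually (p := fun j => j = θ i) (by simp)
  filter_upwards [h.filter_mono nhdsWithin_le_nhds, self_mem_nhdsWithin] with θ' h1 h2
  exact (cfVal_dist h2 hθ N fun i hi => h1 i (Finset.mem_range.mpr hi)).trans_lt hN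

lemma isCompact_E14 : IsCompact E14 := by
  refine IsCompact.image_of_continuousOn ?_ ((continuousOn_cfVal 4).mono fun θ h => h.1)
  have h1 : IsCompact (Set.univ.pi fun _ : ℕ => Set.Icc 1 4) :=
    isCompact_univ_pi fun _ => (Set.finite_Icc 1 4).isCompact
  refine h1.of_isClosed_subset ?_ fun θ h n _ => h.1 n
  have hc : ∀ (n : ℕ) (T : Set ℕ), IsClosed {θ : ℕ → ℕ | θ n ∈ T} := fun n T =>
    (isClosed_discrete T).preimage (continuous_apply n)
  have e : Seq14 = (⋂ n, {θ : ℕ → ℕ | θ n ∈ Set.Icc 1 4}) ∩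
      ⋂ n, ({θ : ℕ → ℕ | θ n ∈ ({1} : Set ℕ)ᶜ} ∪ {θ | θ (n + 1) ∈ ({4} : Set ℕ)ᶜ}) := by
    ext θ
    simp only [Seq14, Digits, Set.mem_ofPred_eq, Set.mem_inter_iff, Set.mem_iInter, Set.mem_Icc,
      Set.mem_union, Set.mem_compl_iff, Set.mem_singleton_iff, imp_iff_not_or, ne_eq]
  rw [e]
  exact (isClosed_iInter fun n => hc n _).inter
    (isClosed_iInter fun n => (hc n _).union (hc (n + 1) _))

/-- The sequence `d, θ 0, θ 1, …`. -/
def consSeq (d : ℕ) (θ : ℕ → ℕ) : ℕ → ℕ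
  | 0 => d
  | n + 1 => θ n

lemma Digits.cons {k d : ℕ} {θ : ℕ → ℕ} (h : Digits k θ) (h1 : 1 ≤ d) (hd : d ≤ k) :
    Digits k (consSeq d θ) := by
  rintro (_ | n)
  · exact ⟨h1, hd⟩
  · exact h n

lemma cfVal_cons {k d : ℕ} {θ : ℕ → ℕ} (h : Digits k θ) (h1 : 1 ≤ d) (hd : d ≤ k) :
    cfVal (consSeq d θ) = 1 / (d + cfVal θ) := cfVal_eq (h.cons h1 hd)

lemma consSeq_mem_Seq14 {d : ℕ} {θ : ℕ → ℕ} (h : θ ∈ Seq14) (h1 : 1 ≤ d) (hd : d ≤ 4)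
    (h4 : d = 1 → θ 0 ≠ 4) : consSeq d θ ∈ Seq14 := by
  refine ⟨h.1.cons h1 hd, ?_⟩
  rintro (_ | n)
  · exact h4
  · exact h.2 n

lemma F14_subset_E14 : F14 ⊆ E14 := Set.image_mono fun _ h => h.1

lemma inv_add_mem_E14 {d : ℕ} {x : ℝ} (hx : x ∈ E14) (h2 : 2 ≤ d) (h4 : d ≤ 4) :
    1 / ((d : ℝ) + x) ∈ E14 := by
  obtain ⟨θ, hθ, rfl⟩ := hx
  exact ⟨consSeq d θ, consSeq_mem_Seq14 hθ (by omega) h4 (by omega),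
    cfVal_cons hθ.1 (by omega) h4⟩

lemma inv_add_mem_F14 {d : ℕ} {x : ℝ} (hx : x ∈ E14) (h2 : 2 ≤ d) (h3 : d ≤ 3) :
    1 / ((d : ℝ) + x) ∈ F14 := by
  obtain ⟨θ, hθ, rfl⟩ := hx
  exact ⟨consSeq d θ, ⟨consSeq_mem_Seq14 hθ (by omega) (by omega) (by omega),
    show d ≠ 4 by omega⟩, cfVal_cons hθ.1 (by omega) (by omega)⟩

lemma inv_one_add_mem_F14 {x : ℝ} (hx : x ∈ F14) : 1 / (1 + x) ∈ F14 := by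
  obtain ⟨θ, hθ, rfl⟩ := hx
  refine ⟨consSeq 1 θ, ⟨consSeq_mem_Seq14 hθ.1 le_rfl (by omega) fun _ => hθ.2,
    show (1 : ℕ) ≠ 4 by omega⟩, ?_⟩
  rw [cfVal_cons hθ.1.1 le_rfl (by omega)]
  simp

/-- The value `[0; 1, 3, 1, 3, …]`, the largest element of `E14`. -/
def mu14 : ℝ := cfVal fun n => if Even n then 1 else 3

lemma mu14_mem : mu14 ∈ F14 := by
  have h : ∀ n : ℕ, (if Even n then 1 else 3) = 1 ∨ (if Even n then 1 else 3) = 3 := fun n => by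
    split_ifs <;> simp
  refine Set.mem_image_of_mem _ ⟨⟨fun n => ?_, fun n _ => ?_⟩, ?_⟩
  · show 1 ≤ (if Even n then 1 else 3) ∧ (if Even n then 1 else 3) ≤ 4
    have := h n
    omega
  · show (if Even (n + 1) then 1 else 3) ≠ 4
    have := h (n + 1)
    omega
  · simp

lemma mu14_eq : mu14 = 1 / (1 + 1 / (3 + mu14)) := by
  have h : Digits 4 fun n => if Even n then 1 else 3 := by
    intro n
    dsimp only
    split_ifs <;> omega
  conv_lhs => rw [mu14, cfVal_eq h, cfVal_eq h.tail]
  simp [mu14, Nat.even_add_one, parity_simps]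

lemma mu14_pos : 0 < mu14 := by
  rw [mu14_eq]
  have : 0 ≤ mu14 := by
    obtain ⟨θ, hθ, h⟩ := mu14_mem
    rw [← h]
    exact cfVal_nonneg hθ.1.1
  positivity

lemma mu14_quadratic : mu14 * mu14 + 3 * mu14 - 3 = 0 := by
  have h := mu14_eq
  have hp := mu14_pos
  have : (1 : ℝ) + 1 / (3 + mu14) = (4 + mu14) / (3 + mu14) := by field_simp; ring
  rw [this, one_div_div, eq_div_iff (by positivity)] at h
  linarith

lemma mu14_bounds : 0.79128 ≤ mu14 ∧ mu14 ≤ 0.79129 := by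
  have h := mu14_quadratic
  have hp := mu14_pos
  constructor <;> nlinarith

/-- Length of the image of `[x, y]` under a Möbius map with denominator `q + r x` and determinant
`±1`. -/
def mobLen (q r x y : ℝ) : ℝ := (y - x) / ((q + r * x) * (q + r * y))

lemma mobLen_le_mobLen {q r : ℝ} (K : ℝ) (hq : 0 < q) (hr : 0 ≤ r) (hrq : r ≤ q)
    {x y z w xl xu yl yu zl zu wl wu : ℝ} (hx : xl ≤ x ∧ x ≤ xu) (hy : yl ≤ y ∧ y ≤ yu)
    (hz : zl ≤ z ∧ z ≤ zu) (hw : wl ≤ w ∧ w ≤ wu)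
    (hpos : 0 ≤ xl ∧ xl ≤ yu ∧ 0 ≤ yl ∧ 0 ≤ zl ∧ 0 ≤ wl ∧ 0 ≤ K ∧ zu ≤ wl)
    (h0 : yu - xl ≤ K * (wl - zu))
    (h1 : (yu - xl) * (2 + zu + wu) ≤ K * (wl - zu) * (2 + xl + yl))
    (h2 : (yu - xl) * ((1 + zu) * (1 + wu)) ≤ K * (wl - zu) * ((1 + xl) * (1 + yl))) :
    mobLen q r x y ≤ K * mobLen q r z w := by
  obtain ⟨p1, p2, p3, p4, p5, p6, p7⟩ := hpos
  have d1 : ∀ {t : ℝ}, 0 ≤ t → 0 < q + r * t := fun ht => by positivity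
  unfold mobLen
  rw [← mul_div_assoc, div_le_div_iff₀ (mul_pos (d1 (p1.trans hx.1)) (d1 (p3.trans hy.1)))
    (mul_pos (d1 (p4.trans hz.1)) (d1 (p5.trans hw.1)))]
  have up : (y - x) * ((q + r * z) * (q + r * w)) ≤
      (yu - xl) * ((q + r * zu) * (q + r * wu)) := by
    have a1 := d1 (p4.trans hz.1)
    have a2 := d1 (p5.trans hw.1)
    have a3 := mul_le_mul_of_nonneg_left hz.2 hr
    have a4 := mul_le_mul_of_nonneg_left hw.2 hr
    apply mul_le_mul (by linarith [hx.1, hy.2]) _ (by positivity) (by linarith)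
    exact mul_le_mul (by linarith) (by linarith) a2.le (by linarith)
  have low : K * (wl - zu) * ((q + r * xl) * (q + r * yl)) ≤
      K * (w - z) * ((q + r * x) * (q + r * y)) := by
    have a1 := d1 p1
    have a2 := d1 p3
    have a3 := mul_le_mul_of_nonneg_left hx.1 hr
    have a4 := mul_le_mul_of_nonneg_left hy.1 hr
    apply mul_le_mul (mul_le_mul_of_nonneg_left (by linarith [hz.2, hw.1]) p6) _ (by positivity)
      (mul_nonneg p6 (by linarith [hz.2, hw.1]))
    exact mul_le_mul (by linarith) (by linarith) a2.le (by linarith)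
  refine up.trans (le_trans ?_ low)
  obtain ⟨s, rfl⟩ : ∃ s, q = r + s := ⟨q - r, by ring⟩
  have hs : 0 ≤ s := by linarith
  have b0 := mul_le_mul_of_nonneg_right h0 (mul_nonneg hs hs)
  have b1 := mul_le_mul_of_nonneg_right h1 (mul_nonneg hs hr)
  have b2 := mul_le_mul_of_nonneg_right h2 (mul_nonneg hr hr)
  linarith

/-- `f` is a Möbius map with denominator `q + r x` and determinant `σ`. -/
structure IsMob (f : ℝ → ℝ) (σ q r : ℝ) : Prop where
  sq : σ = 1 ∨ σ = -1
  q_pos : 0 < q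
  r_nonneg : 0 ≤ r
  r_le : r ≤ q
  sub : ∀ x y, 0 ≤ x → 0 ≤ y → f y - f x = σ * mobLen q r x y

lemma IsMob.comp_inv {f : ℝ → ℝ} {σ q r : ℝ} (h : IsMob f σ q r) {d : ℕ} (hd : 1 ≤ d) :
    IsMob (fun x => f (1 / (d + x))) (-σ) (q * d + r) q := by
  have hd' : (1 : ℝ) ≤ d := by exact_mod_cast hd
  have hq := h.q_pos
  have hr := h.r_nonneg
  refine ⟨?_, by positivity, hq.le, by nlinarith, fun x y hx hy => ?_⟩
  · rcases h.sq with rfl | rfl <;> simp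
  · rw [h.sub _ _ (by positivity) (by positivity), neg_mul, ← mul_neg]
    congr 1
    have e1 : q + r * (1 / (d + x)) = (q * d + r + q * x) / (d + x) := by field_simp; ring
    have e2 : q + r * (1 / (d + y)) = (q * d + r + q * y) / (d + y) := by field_simp; ring
    unfold mobLen
    rw [e1, e2]
    field_simp
    ring

/-- The smallest element of `E14`. -/
def al14 : ℝ := 1 / ((4 : ℕ) + mu14)

/-- The intervals, with the gap to be removed, into which the hulls of `E14` and `F14` are
subdivided until the first digit is determined. -/
inductive Cell : Set ℝ → ℝ → ℝ → ℝ → ℝ → Prop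
  | d1234 : Cell E14 al14 (1 / ((2 : ℕ) + al14)) (1 / ((1 : ℕ) + mu14)) mu14
  | d234 : Cell E14 al14 (1 / ((3 : ℕ) + al14)) (1 / ((2 : ℕ) + mu14)) (1 / ((2 : ℕ) + al14))
  | d34 : Cell E14 al14 (1 / ((4 : ℕ) + al14)) (1 / ((3 : ℕ) + mu14)) (1 / ((3 : ℕ) + al14))
  | d123 : Cell F14 (1 / ((3 : ℕ) + mu14)) (1 / ((2 : ℕ) + al14)) (1 / ((1 : ℕ) + mu14)) mu14
  | d23 : Cell F14 (1 / ((3 : ℕ) + mu14)) (1 / ((3 : ℕ) + al14)) (1 / ((2 : ℕ) + mu14))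
      (1 / ((2 : ℕ) + al14))

/-- A cell, or the image of a cell under `x ↦ 1 / (d + x)`, possibly reversed. -/
def Piece (T : Set ℝ) (u v p o : ℝ) : Prop :=
  Cell T u v p o ∨ ∃ (d : ℕ) (T' : Set ℝ) (a b c e : ℝ), 1 ≤ d ∧ Cell T' a b c e ∧
    (∀ x ∈ T', 1 / ((d : ℝ) + x) ∈ T) ∧ u = 1 / (d + e) ∧ v = 1 / (d + c) ∧ p = 1 / (d + b) ∧
    o = 1 / (d + a)

lemma inv_add_bounds {d : ℕ} {x l u l' u' : ℝ} (h : l ≤ x ∧ x ≤ u)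
    (h' : 0 < d + l ∧ l' * (d + u) ≤ 1 ∧ 1 ≤ u' * (d + l)) :
    l' ≤ 1 / ((d : ℝ) + x) ∧ 1 / ((d : ℝ) + x) ≤ u' := by
  obtain ⟨h1, h2, h3⟩ := h'
  have hp : 0 < (d : ℝ) + x := by linarith [h.1]
  constructor
  · refine le_trans ?_ (one_div_le_one_div_of_le hp (by linarith [h.2] : (d : ℝ) + x ≤ d + u))
    rwa [le_div_iff₀ (by linarith [h.1, h.2])]
  · refine le_trans (one_div_le_one_div_of_le h1 (by linarith [h.1] : (d : ℝ) + l ≤ d + x)) ?_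
    rwa [div_le_iff₀ h1]

lemma al14_bounds : 0.2087 ≤ al14 ∧ al14 ≤ 0.2088 :=
  inv_add_bounds mu14_bounds (by norm_num)

lemma inv_two_al14 : 0.4527 ≤ 1 / (((2 : ℕ) : ℝ) + al14) ∧ 1 / (((2 : ℕ) : ℝ) + al14) ≤ 0.4528 :=
  inv_add_bounds al14_bounds (by norm_num)

lemma inv_three_al14 : 0.3116 ≤ 1 / (((3 : ℕ) : ℝ) + al14) ∧ 1 / (((3 : ℕ) : ℝ) + al14) ≤ 0.3117 :=
  inv_add_bounds al14_bounds (by norm_num)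

lemma inv_four_al14 : 0.2375 ≤ 1 / (((4 : ℕ) : ℝ) + al14) ∧ 1 / (((4 : ℕ) : ℝ) + al14) ≤ 0.2377 :=
  inv_add_bounds al14_bounds (by norm_num)

lemma inv_one_mu14 : 0.5582 ≤ 1 / (((1 : ℕ) : ℝ) + mu14) ∧ 1 / (((1 : ℕ) : ℝ) + mu14) ≤ 0.5583 :=
  inv_add_bounds mu14_bounds (by norm_num)

lemma inv_two_mu14 : 0.3582 ≤ 1 / (((2 : ℕ) : ℝ) + mu14) ∧ 1 / (((2 : ℕ) : ℝ) + mu14) ≤ 0.3583 :=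
  inv_add_bounds mu14_bounds (by norm_num)

lemma inv_three_mu14 : 0.2637 ≤ 1 / (((3 : ℕ) : ℝ) + mu14) ∧ 1 / (((3 : ℕ) : ℝ) + mu14) ≤ 0.2638 :=
  inv_add_bounds mu14_bounds (by norm_num)

lemma al14_mem : al14 ∈ E14 :=
  inv_add_mem_E14 (F14_subset_E14 mu14_mem) (by norm_num) le_rfl

set_option maxHeartbeats 1000000 in
/-- The gaps inside two adjacent pieces, separated by `(v, p)`, are smaller than `(v, p)`. -/
lemma Cell.pieces {T : Set ℝ} {u v p o : ℝ} (h : Cell T u v p o) :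
    (∃ v' p', Piece T u v' p' v ∧ 0 ≤ v' ∧ v' ≤ p' ∧ ∀ q r, 0 < q → 0 ≤ r → r ≤ q →
      mobLen q r v' p' ≤ 1 * mobLen q r v p) ∧
    (∃ v' p', Piece T p v' p' o ∧ 0 ≤ v' ∧ v' ≤ p' ∧ ∀ q r, 0 < q → 0 ≤ r → r ≤ q →
      mobLen q r v' p' ≤ 1 * mobLen q r v p) := by
  have hmu : mu14 = 1 / ((1 : ℕ) + 1 / ((3 : ℕ) + mu14)) := by
    have := mu14_eq
    push_cast
    exact this
  have g1 := inv_add_bounds (d := 1) (l' := 0.64) (u' := 0.645) inv_one_mu14 (by norm_num)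
  have g1' := inv_add_bounds (d := 1) (l' := 0.685) (u' := 0.69) inv_two_al14 (by norm_num)
  have g2 := inv_add_bounds (d := 2) (l' := 0.39) (u' := 0.395) inv_one_mu14 (by norm_num)
  have g2' := inv_add_bounds (d := 2) (l' := 0.405) (u' := 0.41) inv_two_al14 (by norm_num)
  have g3 := inv_add_bounds (d := 3) (l' := 0.28) (u' := 0.2815) inv_one_mu14 (by norm_num)
  have g3' := inv_add_bounds (d := 3) (l' := 0.289) (u' := 0.29) inv_two_al14 (by norm_num)
  have g4 := inv_add_bounds (d := 4) (l' := 0.219) (u' := 0.22) inv_one_mu14 (by norm_num)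
  have g4' := inv_add_bounds (d := 4) (l' := 0.224) (u' := 0.225) inv_two_al14 (by norm_num)
  have hF : ∀ x ∈ F14, 1 / (((1 : ℕ) : ℝ) + x) ∈ F14 := fun x hx => by
    simpa using inv_one_add_mem_F14 hx
  have hE : ∀ d : ℕ, 2 ≤ d → d ≤ 4 → ∀ x ∈ E14, 1 / ((d : ℝ) + x) ∈ E14 :=
    fun d h2 h4 x hx => inv_add_mem_E14 hx h2 h4
  have hEF : ∀ d : ℕ, 2 ≤ d → d ≤ 3 → ∀ x ∈ E14, 1 / ((d : ℝ) + x) ∈ F14 :=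
    fun d h2 h4 x hx => inv_add_mem_F14 hx h2 h4
  have ⟨_, _⟩ := g1
  have ⟨_, _⟩ := g1'
  have ⟨_, _⟩ := g2
  have ⟨_, _⟩ := g2'
  have ⟨_, _⟩ := g3
  have ⟨_, _⟩ := g3'
  have ⟨_, _⟩ := g4
  have ⟨_, _⟩ := g4'
  have ⟨_, _⟩ := inv_two_al14
  have ⟨_, _⟩ := inv_three_al14
  have ⟨_, _⟩ := inv_four_al14
  have ⟨_, _⟩ := inv_one_mu14
  have ⟨_, _⟩ := inv_two_mu14
  have ⟨_, _⟩ := inv_three_mu14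
  cases h with
  | d1234 =>
    refine ⟨⟨_, _, .inl .d234, ?_, ?_, fun q r hq hr hrq => mobLen_le_mobLen 1 hq hr hrq
        inv_three_al14 inv_two_mu14 inv_two_al14 inv_one_mu14 ?_ ?_ ?_ ?_⟩,
      ⟨_, _, .inr ⟨1, _, _, _, _, _, by norm_num, .d123, fun x hx => F14_subset_E14 (hF x hx),
          rfl, rfl, rfl, hmu⟩,
        ?_, ?_, fun q r hq hr hrq => mobLen_le_mobLen 1 hq hr hrq
        g1 g1' inv_two_al14 inv_one_mu14 ?_ ?_ ?_ ?_⟩⟩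
    all_goals first | (norm_num; done) | linarith
  | d234 =>
    refine ⟨⟨_, _, .inl .d34, ?_, ?_, fun q r hq hr hrq => mobLen_le_mobLen 1 hq hr hrq
        inv_four_al14 inv_three_mu14 inv_three_al14 inv_two_mu14 ?_ ?_ ?_ ?_⟩,
      ⟨_, _, .inr ⟨2, _, _, _, _, _, by norm_num, .d1234, hE 2 (by norm_num) (by norm_num), rfl,
          rfl, rfl, rfl⟩,
        ?_, ?_, fun q r hq hr hrq => mobLen_le_mobLen 1 hq hr hrq
        g2 g2' inv_three_al14 inv_two_mu14 ?_ ?_ ?_ ?_⟩⟩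
    all_goals first | (norm_num; done) | linarith
  | d34 =>
    refine ⟨⟨_, _, .inr ⟨4, _, _, _, _, _, by norm_num, .d1234, hE 4 (by norm_num) (by norm_num),
        rfl, rfl, rfl, rfl⟩,
        ?_, ?_, fun q r hq hr hrq => mobLen_le_mobLen 1 hq hr hrq
        g4 g4' inv_four_al14 inv_three_mu14 ?_ ?_ ?_ ?_⟩,
      ⟨_, _, .inr ⟨3, _, _, _, _, _, by norm_num, .d1234, hE 3 (by norm_num) (by norm_num), rfl,
          rfl, rfl, rfl⟩,
        ?_, ?_, fun q r hq hr hrq => mobLen_le_mobLen 1 hq hr hrq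
        g3 g3' inv_four_al14 inv_three_mu14 ?_ ?_ ?_ ?_⟩⟩
    all_goals first | (norm_num; done) | linarith
  | d123 =>
    refine ⟨⟨_, _, .inl .d23, ?_, ?_, fun q r hq hr hrq => mobLen_le_mobLen 1 hq hr hrq
        inv_three_al14 inv_two_mu14 inv_two_al14 inv_one_mu14 ?_ ?_ ?_ ?_⟩,
      ⟨_, _, .inr ⟨1, _, _, _, _, _, by norm_num, .d123, hF, rfl, rfl, rfl, hmu⟩,
        ?_, ?_, fun q r hq hr hrq => mobLen_le_mobLen 1 hq hr hrq
        g1 g1' inv_two_al14 inv_one_mu14 ?_ ?_ ?_ ?_⟩⟩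
    all_goals first | (norm_num; done) | linarith
  | d23 =>
    refine ⟨⟨_, _, .inr ⟨3, _, _, _, _, _, by norm_num, .d1234, hEF 3 (by norm_num) (by norm_num),
        rfl, rfl, rfl, rfl⟩,
        ?_, ?_, fun q r hq hr hrq => mobLen_le_mobLen 1 hq hr hrq
        g3 g3' inv_three_al14 inv_two_mu14 ?_ ?_ ?_ ?_⟩,
      ⟨_, _, .inr ⟨2, _, _, _, _, _, by norm_num, .d1234, hEF 2 (by norm_num) (by norm_num), rfl,
          rfl, rfl, rfl⟩,
        ?_, ?_, fun q r hq hr hrq => mobLen_le_mobLen 1 hq hr hrq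
        g2 g2' inv_three_al14 inv_two_mu14 ?_ ?_ ?_ ?_⟩⟩
    all_goals first | (norm_num; done) | linarith

set_option maxHeartbeats 1000000 in
/-- Position and size of the gap of a cell. -/
lemma Cell.gap {T : Set ℝ} {u v p o : ℝ} (h : Cell T u v p o) :
    (u ∈ T ∧ o ∈ T) ∧ 0 ≤ u ∧ u ≤ v ∧ v < p ∧ p ≤ o ∧ ∀ q r, 0 < q → 0 ≤ r → r ≤ q →
      mobLen q r v p ≤ 1 * mobLen q r u v ∧ mobLen q r v p ≤ 1 * mobLen q r p o ∧
      mobLen q r u o ≤ 20 * mobLen q r v p := by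
  have hE : ∀ d : ℕ, 2 ≤ d → d ≤ 3 → 1 / ((d : ℝ) + al14) ∈ E14 :=
    fun d h2 h3 => inv_add_mem_E14 al14_mem h2 (by omega)
  have hF : ∀ d : ℕ, 2 ≤ d → d ≤ 3 → 1 / ((d : ℝ) + al14) ∈ F14 :=
    fun d h2 h3 => inv_add_mem_F14 al14_mem h2 h3
  have hmu : 1 / (((3 : ℕ) : ℝ) + mu14) ∈ F14 :=
    inv_add_mem_F14 (F14_subset_E14 mu14_mem) (by norm_num) le_rfl
  have ⟨_, _⟩ := al14_bounds
  have ⟨_, _⟩ := mu14_bounds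
  have ⟨_, _⟩ := inv_two_al14
  have ⟨_, _⟩ := inv_three_al14
  have ⟨_, _⟩ := inv_four_al14
  have ⟨_, _⟩ := inv_one_mu14
  have ⟨_, _⟩ := inv_two_mu14
  have ⟨_, _⟩ := inv_three_mu14
  cases h with
  | d1234 =>
    refine ⟨⟨al14_mem, F14_subset_E14 mu14_mem⟩, ?_, ?_, ?_, ?_, fun q r hq hr hrq => ⟨
      mobLen_le_mobLen _ hq hr hrq inv_two_al14 inv_one_mu14 al14_bounds inv_two_al14 ?_ ?_ ?_ ?_,
      mobLen_le_mobLen _ hq hr hrq inv_two_al14 inv_one_mu14 inv_one_mu14 mu14_bounds ?_ ?_ ?_ ?_,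
      mobLen_le_mobLen _ hq hr hrq al14_bounds mu14_bounds inv_two_al14 inv_one_mu14 ?_ ?_ ?_ ?_⟩⟩
    all_goals first | (norm_num; done) | linarith
  | d234 =>
    refine ⟨⟨al14_mem, hE 2 le_rfl (by norm_num)⟩, ?_, ?_, ?_, ?_, fun q r hq hr hrq => ⟨
      mobLen_le_mobLen _ hq hr hrq inv_three_al14 inv_two_mu14 al14_bounds inv_three_al14 ?_ ?_ ?_
        ?_,
      mobLen_le_mobLen _ hq hr hrq inv_three_al14 inv_two_mu14 inv_two_mu14 inv_two_al14 ?_ ?_ ?_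
        ?_,
      mobLen_le_mobLen _ hq hr hrq al14_bounds inv_two_al14 inv_three_al14 inv_two_mu14 ?_ ?_ ?_
        ?_⟩⟩
    all_goals first | (norm_num; done) | linarith
  | d34 =>
    refine ⟨⟨al14_mem, hE 3 (by norm_num) le_rfl⟩, ?_, ?_, ?_, ?_, fun q r hq hr hrq => ⟨
      mobLen_le_mobLen _ hq hr hrq inv_four_al14 inv_three_mu14 al14_bounds inv_four_al14 ?_ ?_ ?_
        ?_,
      mobLen_le_mobLen _ hq hr hrq inv_four_al14 inv_three_mu14 inv_three_mu14 inv_three_al14 ?_ ?_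
        ?_ ?_,
      mobLen_le_mobLen _ hq hr hrq al14_bounds inv_three_al14 inv_four_al14 inv_three_mu14 ?_ ?_ ?_
        ?_⟩⟩
    all_goals first | (norm_num; done) | linarith
  | d123 =>
    refine ⟨⟨hmu, mu14_mem⟩, ?_, ?_, ?_, ?_, fun q r hq hr hrq => ⟨
      mobLen_le_mobLen _ hq hr hrq inv_two_al14 inv_one_mu14 inv_three_mu14 inv_two_al14 ?_ ?_ ?_
        ?_,
      mobLen_le_mobLen _ hq hr hrq inv_two_al14 inv_one_mu14 inv_one_mu14 mu14_bounds ?_ ?_ ?_ ?_,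
      mobLen_le_mobLen _ hq hr hrq inv_three_mu14 mu14_bounds inv_two_al14 inv_one_mu14 ?_ ?_ ?_
        ?_⟩⟩
    all_goals first | (norm_num; done) | linarith
  | d23 =>
    refine ⟨⟨hmu, hF 2 le_rfl (by norm_num)⟩, ?_, ?_, ?_, ?_, fun q r hq hr hrq => ⟨
      mobLen_le_mobLen _ hq hr hrq inv_three_al14 inv_two_mu14 inv_three_mu14 inv_three_al14 ?_ ?_
        ?_ ?_,
      mobLen_le_mobLen _ hq hr hrq inv_three_al14 inv_two_mu14 inv_two_mu14 inv_two_al14 ?_ ?_ ?_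
        ?_,
      mobLen_le_mobLen _ hq hr hrq inv_three_mu14 inv_two_al14 inv_three_al14 inv_two_mu14 ?_ ?_ ?_
        ?_⟩⟩
    all_goals first | (norm_num; done) | linarith

/-- Images in `E14` of the cells under Möbius maps, written in increasing order. -/
def Bridge (a b c d : ℝ) : Prop :=
  ∃ (f : ℝ → ℝ) (σ q r : ℝ) (T : Set ℝ) (u v p o : ℝ), IsMob f σ q r ∧ (∀ e ∈ T, f e ∈ E14) ∧
    Cell T u v p o ∧ ((σ = 1 ∧ a = f u ∧ b = f v ∧ c = f p ∧ d = f o) ∨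
      (σ = -1 ∧ a = f o ∧ b = f p ∧ c = f v ∧ d = f u))

lemma Piece.bridge {f : ℝ → ℝ} {σ q r : ℝ} {T : Set ℝ} {u v p o : ℝ} (hf : IsMob f σ q r)
    (hT : ∀ e ∈ T, f e ∈ E14) (h : Piece T u v p o) :
    (σ = 1 → Bridge (f u) (f v) (f p) (f o)) ∧ (σ = -1 → Bridge (f o) (f p) (f v) (f u)) := by
  rcases h with h | ⟨d, T', a, b, c, e, hd, h, hT', rfl, rfl, rfl, rfl⟩
  · exact ⟨fun hσ => ⟨f, σ, q, r, T, u, v, p, o, hf, hT, h, .inl ⟨hσ, rfl, rfl, rfl, rfl⟩⟩,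
      fun hσ => ⟨f, σ, q, r, T, u, v, p, o, hf, hT, h, .inr ⟨hσ, rfl, rfl, rfl, rfl⟩⟩⟩
  · have hg := hf.comp_inv hd
    have hgT : ∀ x ∈ T', f (1 / (d + x)) ∈ E14 := fun x hx => hT _ (hT' x hx)
    exact ⟨fun hσ => ⟨_, _, _, _, T', a, b, c, e, hg, hgT, h,
        .inr ⟨by rw [hσ], rfl, rfl, rfl, rfl⟩⟩,
      fun hσ => ⟨_, _, _, _, T', a, b, c, e, hg, hgT, h,
        .inl ⟨by rw [hσ, neg_neg], rfl, rfl, rfl, rfl⟩⟩⟩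

lemma Bridge.step {a b c d : ℝ} (h : Bridge a b c d) :
    (a ∈ E14 ∧ d ∈ E14) ∧ 0 < c - b ∧ c - b ≤ b - a ∧ c - b ≤ d - c ∧ d - a ≤ 20 * (c - b) ∧
      (∃ b' c', Bridge a b' c' b ∧ c' - b' ≤ c - b) ∧
      (∃ b' c', Bridge c b' c' d ∧ c' - b' ≤ c - b) := by
  obtain ⟨f, σ, q, r, T, u, v, p, o, hf, hT, hc, ho⟩ := h
  obtain ⟨⟨hu, ho'⟩, u0, uv, vp, po, hl⟩ := hc.gap
  obtain ⟨⟨v₁, p₁, hp₁, v₁0, vp₁, hl₁⟩, ⟨v₂, p₂, hp₂, v₂0, vp₂, hl₂⟩⟩ := hc.pieces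
  obtain ⟨l1, l2, l3⟩ := hl q r hf.q_pos hf.r_nonneg hf.r_le
  have l4 := hl₁ q r hf.q_pos hf.r_nonneg hf.r_le
  have l5 := hl₂ q r hf.q_pos hf.r_nonneg hf.r_le
  have hv0 : 0 ≤ v := u0.trans uv
  have hp0 : 0 ≤ p := hv0.trans vp.le
  have ho0 : 0 ≤ o := hp0.trans po
  have hq := hf.q_pos
  have hr := hf.r_nonneg
  have hpos : 0 < mobLen q r v p :=
    div_pos (sub_pos.2 vp) (mul_pos (by positivity) (by positivity))
  have s1 := hf.sub u v u0 hv0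
  have s2 := hf.sub v p hv0 hp0
  have s3 := hf.sub p o hp0 ho0
  have s4 := hf.sub u o u0 ho0
  have s5 := hf.sub v₁ p₁ v₁0 (v₁0.trans vp₁)
  have s6 := hf.sub v₂ p₂ v₂0 (v₂0.trans vp₂)
  rcases ho with ⟨rfl, rfl, rfl, rfl, rfl⟩ | ⟨rfl, rfl, rfl, rfl, rfl⟩
  · exact ⟨⟨hT _ hu, hT _ ho'⟩, by linarith, by linarith, by linarith, by linarith,
      ⟨_, _, (hp₁.bridge hf hT).1 rfl, by linarith⟩, ⟨_, _, (hp₂.bridge hf hT).1 rfl, by linarith⟩⟩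
  · exact ⟨⟨hT _ ho', hT _ hu⟩, by linarith, by linarith, by linarith, by linarith,
      ⟨_, _, (hp₂.bridge hf hT).2 rfl, by linarith⟩, ⟨_, _, (hp₁.bridge hf hT).2 rfl, by linarith⟩⟩

lemma mem_E14_add_E14 {t : ℝ} (hl : 1 / 2 ≤ t) (hr : t ≤ 3 / 2) : t ∈ E14 + E14 := by
  have hid : IsMob id 1 1 0 := ⟨.inl rfl, one_pos, le_rfl, zero_le_one, fun x y _ _ => by
    simp [mobLen]⟩
  refine mem_add_of_bridges Bridge isCompact_E14 20 (fun a b c d h => h.step)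
    (⟨id, 1, 1, 0, _, _, _, _, _, hid, fun _ h => h, .d1234, .inl ⟨rfl, rfl, rfl, rfl, rfl⟩⟩) ?_ ?_
  · simp only [id]; linarith [al14_bounds.2]
  · simp only [id]; linarith [mu14_bounds.1]

lemma app_nil (θ : ℕ → ℕ) : app [] θ = θ := by
  funext n
  simp [app]

lemma app_cons_zero (x : ℕ) (l : List ℕ) (θ : ℕ → ℕ) : app (x :: l) θ 0 = x := by
  simp [app]

lemma app_cons_succ (x : ℕ) (l : List ℕ) (θ : ℕ → ℕ) (n : ℕ) :
    app (x :: l) θ (n + 1) = app l θ n := by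
  simp [app]

lemma app_append (a b : List ℕ) (θ : ℕ → ℕ) : app (a ++ b) θ = app a (app b θ) := by
  induction a with
  | nil => simp [app_nil]
  | cons x l ih =>
    funext n
    cases n with
    | zero => simp [app_cons_zero]
    | succ n => simp [app_cons_succ, ih]

lemma betaW_succ (k p : ℕ) : betaW k (p + 1) = 1 :: k :: betaW k p := by
  simp [betaW, List.replicate_succ]

lemma app_betaW (k p : ℕ) (θ : ℕ → ℕ) (n : ℕ) : app (betaW k p) θ n =
    if n < 2 * p then (if Even n then 1 else k) else θ (n - 2 * p) := by
  induction p generalizing n with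
  | zero => simp [betaW, app_nil]
  | succ p ih =>
    rw [betaW_succ]
    match n with
    | 0 => simp [app_cons_zero]
    | 1 =>
      simp only [app_cons_succ, app_cons_zero]
      rw [if_pos (by omega), if_neg (by decide)]
    | n + 2 =>
      rw [app_cons_succ, app_cons_succ, ih]
      have h1 : n + 2 < 2 * (p + 1) ↔ n < 2 * p := by omega
      have h2 : n + 2 - 2 * (p + 1) = n - 2 * p := by omega
      simp only [h1, h2, Nat.even_add, even_two, iff_true]

/-- The bi-infinite sequence with `k` at the origin, `(1,k)_p θ` to its right and, read outwards,
`(1,k)_q η` to its left. -/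
def betaSeq (k p q : ℕ) (θ η : ℕ → ℕ) (z : ℤ) : ℕ :=
  if z < -(2 * q) then η (-1 - 2 * q - z).toNat
  else if z ≤ 2 * p then (if Even z then k else 1) else θ (z - 1 - 2 * p).toNat

lemma betaSeq_block {k p q : ℕ} {θ η : ℕ → ℕ} {z : ℤ} (h1 : -(2 * q) ≤ z) (h2 : z ≤ 2 * p) :
    betaSeq k p q θ η z = if Even z then k else 1 := by
  rw [betaSeq, if_neg (by omega), if_pos h2]

lemma betaSeq_right {k p q : ℕ} {θ η : ℕ → ℕ} (n : ℕ) :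
    betaSeq k p q θ η (2 * p + 1 + n) = θ n := by
  rw [betaSeq, if_neg (by omega), if_neg (by omega)]
  congr
  omega

lemma betaSeq_left {k p q : ℕ} {θ η : ℕ → ℕ} (n : ℕ) :
    betaSeq k p q θ η (-(2 * q) - 1 - n) = η n := by
  rw [betaSeq, if_pos (by omega)]
  congr
  omega

lemma lamCF_betaSeq (k p q : ℕ) (θ η : ℕ → ℕ) : lamCF (betaSeq k p q θ η) 0 =
    k + cfVal (app (betaW k p) θ) + cfVal (app (betaW k q) η) := by
  have h0 : betaSeq k p q θ η 0 = k := by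
    rw [betaSeq_block (by omega) (by omega)]
    simp
  have h1 : (fun n : ℕ => betaSeq k p q θ η (0 + 1 + n)) = app (betaW k p) θ := by
    funext n
    rw [app_betaW]
    split_ifs with h h'
    · rw [betaSeq_block (by omega) (by omega), if_neg]
      rw [Int.even_iff]
      rw [Nat.even_iff] at h'
      omega
    · rw [betaSeq_block (by omega) (by omega), if_pos]
      rw [Int.even_iff]
      rw [Nat.even_iff] at h'
      omega
    · rw [← betaSeq_right (k := k) (p := p) (q := q) (θ := θ) (η := η) (n - 2 * p)]
      congr 1
      omega
  have h2 : (fun n : ℕ => betaSeq k p q θ η (0 - 1 - n)) = app (betaW k q) η := by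
    funext n
    rw [app_betaW]
    split_ifs with h h'
    · rw [betaSeq_block (by omega) (by omega), if_neg]
      rw [Int.even_iff]
      rw [Nat.even_iff] at h'
      omega
    · rw [betaSeq_block (by omega) (by omega), if_pos]
      rw [Int.even_iff]
      rw [Nat.even_iff] at h'
      omega
    · rw [← betaSeq_left (k := k) (p := p) (q := q) (θ := θ) (η := η) (n - 2 * q)]
      congr 1
      omega
  rw [lamCF, h0, h1, h2]

lemma betaSeq_digits {k p q K : ℕ} {θ η : ℕ → ℕ} (hk : 1 ≤ k ∧ k ≤ K) (hθ : Digits K θ)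
    (hη : Digits K η) (z : ℤ) : 1 ≤ betaSeq k p q θ η z ∧ betaSeq k p q θ η z ≤ K := by
  unfold betaSeq
  split_ifs
  exacts [hη _, hk, ⟨le_rfl, hk.1.trans hk.2⟩, hθ _]

/-- The map `[0; a] ↦ [0; 1, k, a]`. -/
def betaMap (k : ℕ) (t : ℝ) : ℝ := 1 / (1 + 1 / (k + t))

lemma betaMap_nonneg {k : ℕ} {t : ℝ} (ht : 0 ≤ t) : 0 ≤ betaMap k t := by
  unfold betaMap
  positivity

lemma betaMap_iterate_nonneg {k : ℕ} {t : ℝ} (ht : 0 ≤ t) (n : ℕ) : 0 ≤ (betaMap k)^[n] t := by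
  induction n with
  | zero => exact ht
  | succ n ih =>
    rw [Function.iterate_succ_apply']
    exact betaMap_nonneg ih

lemma betaMap_eq {k : ℕ} (hk : 1 ≤ k) {t : ℝ} (ht : 0 ≤ t) :
    betaMap k t = 1 - 1 / (k + 1 + t) := by
  have : (1 : ℝ) ≤ k := by exact_mod_cast hk
  unfold betaMap
  field_simp
  ring

lemma betaMap_mono {k : ℕ} (hk : 1 ≤ k) {s t : ℝ} (hs : 0 ≤ s) (hst : s ≤ t) :
    betaMap k s ≤ betaMap k t := by
  rw [betaMap_eq hk hs, betaMap_eq hk (hs.trans hst)]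
  have := one_div_le_one_div_of_le (by positivity : (0 : ℝ) < k + 1 + s)
    (by linarith : (k : ℝ) + 1 + s ≤ k + 1 + t)
  linarith

lemma betaMap_sub_le {k : ℕ} (hk : 1 ≤ k) {s t : ℝ} (hs : 0 ≤ s) (hst : s ≤ t) :
    betaMap k t - betaMap k s ≤ t - s := by
  rw [betaMap_eq hk hs, betaMap_eq hk (hs.trans hst)]
  have ht : 0 ≤ t := hs.trans hst
  have e : 1 - 1 / ((k : ℝ) + 1 + t) - (1 - 1 / (k + 1 + s)) =
      (t - s) / ((k + 1 + s) * (k + 1 + t)) := by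
    field_simp
    ring
  rw [e]
  have hk' : (0 : ℝ) ≤ k := by positivity
  exact div_le_self (by linarith) (by nlinarith [mul_nonneg hs ht])

lemma betaMap_iterate_mono {k : ℕ} (hk : 1 ≤ k) {s t : ℝ} (hs : 0 ≤ s) (hst : s ≤ t) (n : ℕ) :
    (betaMap k)^[n] s ≤ (betaMap k)^[n] t := by
  induction n with
  | zero => exact hst
  | succ n ih =>
    rw [Function.iterate_succ_apply', Function.iterate_succ_apply']
    exact betaMap_mono hk (betaMap_iterate_nonneg hs n) ih

lemma betaMap_iterate_sub_le {k : ℕ} (hk : 1 ≤ k) {s t : ℝ} (hs : 0 ≤ s) (hst : s ≤ t) (n : ℕ) :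
    (betaMap k)^[n] t - (betaMap k)^[n] s ≤ t - s := by
  induction n with
  | zero => exact le_rfl
  | succ n ih =>
    rw [Function.iterate_succ_apply', Function.iterate_succ_apply']
    exact (betaMap_sub_le hk (betaMap_iterate_nonneg hs n) (betaMap_iterate_mono hk hs hst n)).trans
      ih

/-- Shifting the origin by `i` inside a block of the letters `1, k` decreases the value as soon as
the shorter side dominates. -/
lemma betaMap_iterate_add_le {k : ℕ} (hk : 1 ≤ k) {x y : ℝ} (hx : 0 ≤ x) (hy : 0 ≤ y) (a q i : ℕ)
    (h : (a = q ∧ x ≤ y) ∨ (a < q ∧ x ≤ betaMap k 0)) :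
    (betaMap k)^[a] x + (betaMap k)^[q + i] y ≤ (betaMap k)^[a + i] x + (betaMap k)^[q] y := by
  have key : (betaMap k)^[a] x ≤ (betaMap k)^[q] y := by
    rcases h with ⟨rfl, h⟩ | ⟨haq, h⟩
    · exact betaMap_iterate_mono hk hx h a
    · obtain ⟨b, rfl⟩ := Nat.exists_eq_add_of_lt haq
      rw [add_assoc, Function.iterate_add_apply]
      refine betaMap_iterate_mono hk hx (h.trans ?_) a
      rw [Function.iterate_succ_apply']
      exact betaMap_mono hk le_rfl (betaMap_iterate_nonneg hy b)
  have := betaMap_iterate_sub_le hk (betaMap_iterate_nonneg hx a) key i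
  rw [← Function.iterate_add_apply, ← Function.iterate_add_apply] at this
  rw [add_comm q, add_comm a]
  linarith

lemma cfVal_two_step {k : ℕ} {a : ℕ → ℕ} (h : Digits k a) :
    cfVal a = 1 / (a 0 + 1 / (a 1 + cfVal fun n => a (n + 2))) := by
  rw [cfVal_eq h, cfVal_eq h.tail]

lemma cfVal_eq_betaMap_iterate {k n : ℕ} {a : ℕ → ℕ} (h : Digits k a)
    (ha : ∀ i < 2 * n, a i = if Even i then 1 else k) :
    cfVal a = (betaMap k)^[n] (cfVal fun i => a (i + 2 * n)) := by
  induction n generalizing a with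
  | zero => rfl
  | succ n ih =>
    rw [cfVal_two_step h, ih h.tail.tail, Function.iterate_succ_apply', betaMap, ha 0 (by omega),
      ha 1 (by omega)]
    · norm_num
      rfl
    · intro i hi
      have := ha (i + 2) (by omega)
      simpa [Nat.even_add] using this

lemma lamCF_block {k p q : ℕ} {V : ℤ → ℕ} (hV : ∀ i, 1 ≤ V i ∧ V i ≤ k)
    (hB : ∀ z : ℤ, -(2 * q) ≤ z → z ≤ 2 * p → V z = if Even z then k else 1) {i : ℤ} {a b : ℕ}
    (ha : i + a = p) (hb : (b : ℤ) = q + i) :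
    lamCF V (2 * i) = k + (betaMap k)^[a] (cfVal fun n => V (2 * p + 1 + n)) +
      (betaMap k)^[b] (cfVal fun n => V (-(2 * q) - 1 - n)) := by
  have e0 : V (2 * i) = k := by
    rw [hB _ (by omega) (by omega), if_pos (even_two_mul i)]
  rw [lamCF, e0, cfVal_eq_betaMap_iterate (n := a) (Digits.right hV (2 * i)),
    cfVal_eq_betaMap_iterate (n := b) (Digits.left hV (2 * i))]
  · congr 4
    · funext n
      congr 1
      push_cast
      linarith
    · funext n
      congr 1
      push_cast
      linarith
  all_goals
    intro n hn
    rw [hB _ (by omega) (by omega)]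
    by_cases h : Even n
    · rw [if_pos h, if_neg]
      rw [Int.even_iff]
      rw [Nat.even_iff] at h
      omega
    · rw [if_neg h, if_pos]
      rw [Int.even_iff]
      rw [Nat.even_iff] at h
      omega

lemma lamCF_le {k : ℕ} {V : ℤ → ℕ} (hV : ∀ i, 1 ≤ V i ∧ V i ≤ k) (j : ℤ) :
    lamCF V j ≤ V j + 2 := by
  have h1 := cfVal_le_one (Digits.right hV j)
  have h2 := cfVal_le_one (Digits.left hV j)
  rw [lamCF]
  linarith

lemma cfVal_le_of_two_digits {k : ℕ} {a : ℕ → ℕ} (h : Digits k a) {c : ℕ} (hc : a 1 ≤ c) :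
    cfVal a ≤ 1 / (1 + 1 / (c + 1)) := by
  have h0 : (1 : ℝ) ≤ a 0 := by exact_mod_cast (h 0).1
  have h1 : (1 : ℝ) ≤ a 1 := by exact_mod_cast (h 1).1
  have hc' : (a 1 : ℝ) ≤ c := by exact_mod_cast hc
  have hr := cfVal_nonneg h.tail.tail
  have hr1 := cfVal_le_one h.tail.tail
  rw [cfVal_two_step h]
  have := one_div_le_one_div_of_le (by linarith : (0 : ℝ) < a 1 + cfVal fun n => a (n + 2))
    (by linarith : (a 1 : ℝ) + (cfVal fun n => a (n + 2)) ≤ c + 1)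
  exact one_div_le_one_div_of_le (by positivity) (by linarith)

/-- The largest value starts with the digits `1, k - 1`. -/
lemma cfVal_le_cfVal_of_ne {k : ℕ} (hk : 2 ≤ k) {a b : ℕ → ℕ} (ha : Digits k a) (hb : Digits k b)
    (ha1 : a 1 ≤ k - 1) (hne : (a 0, a 1) ≠ (1, k - 1)) (hb0 : b 0 = 1) (hb1 : b 1 = k - 1) :
    cfVal a ≤ cfVal b := by
  obtain ⟨l, rfl⟩ : ∃ l, k = l + 2 := ⟨k - 2, by omega⟩
  have hl : (0 : ℝ) ≤ l := by positivity
  have hlow : 1 / (1 + 1 / ((l : ℝ) + 1)) ≤ cfVal b := by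
    have hr := cfVal_nonneg hb.tail.tail
    rw [cfVal_two_step hb, hb0, hb1]
    have := one_div_le_one_div_of_le (by positivity : (0 : ℝ) < (l : ℝ) + 1)
      (by linarith : (l : ℝ) + 1 ≤ l + 1 + cfVal fun n => b (n + 2))
    push_cast
    refine one_div_le_one_div_of_le (by positivity) (by simpa using this)
  refine le_trans ?_ hlow
  by_cases h : a 1 ≤ l
  · exact cfVal_le_of_two_digits ha h
  · have h0 : 2 ≤ a 0 := by
      have := (ha 0).1
      by_contra hc
      exact hne (Prod.ext (by simp; omega) (by simp; omega))
    have h0' : (2 : ℝ) ≤ a 0 := by exact_mod_cast h0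
    refine (cfVal_le_inv ha).trans (one_div_le_one_div_of_le (by positivity) ?_)
    have : 1 / ((l : ℝ) + 1) ≤ 1 := by
      rw [div_le_one (by positivity)]
      linarith
    linarith

/-- Around the digit `k`, any two sides `(1,k)_p θ` and `(1,k)_q η` give an element of the
Lagrange spectrum, provided the block of letters `1, k` is balanced around the origin. -/
theorem add_cfVal_app_betaW_mem_LSpecK {k p q : ℕ} (hk : 2 ≤ k) {θ η : ℕ → ℕ}
    (hθ : Digits (k - 1) θ) (hη : Digits (k - 1) η)
    (hx : 1 ≤ cfVal (app (betaW k p) θ) + cfVal (app (betaW k q) η))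
    (hpq : p = q ∨ (p = q + 1 ∧ (θ 0, θ 1) ≠ (1, k - 1) ∧ η 0 = 1 ∧ η 1 = k - 1)) :
    k + cfVal (app (betaW k p) θ) + cfVal (app (betaW k q) η) ∈ LSpecK k := by
  rw [← lamCF_betaSeq]
  refine lamCF_zero_mem_LSpecK (betaSeq_digits ⟨by omega, le_rfl⟩ (hθ.mono (by omega))
    (hη.mono (by omega))) (2 * (p + q) + 2) fun m hm V hV hVW j hj hj' hj0 => ?_
  have hx' : (k : ℝ) + 1 ≤ lamCF (betaSeq k p q θ η) 0 := by
    rw [lamCF_betaSeq]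
    linarith
  by_cases hVj : V j ≤ k - 1
  · refine le_max_of_le_left (le_trans ((lamCF_le hV j).trans ?_) hx')
    have : (V j : ℝ) + 1 ≤ k := by exact_mod_cast (by omega : V j + 1 ≤ k)
    linarith
  refine le_max_of_le_right ?_
  have hB : ∀ z : ℤ, -(2 * q) ≤ z → z ≤ 2 * p → V z = if Even z then k else 1 := fun z h1 h2 => by
    rw [hVW z (by omega) (by omega), betaSeq_block h1 h2]
  have hT : ∀ n : ℕ, n < 2 → V (2 * p + 1 + n) = θ n := fun n hn => by
    rw [hVW _ (by omega) (by omega), betaSeq_right]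
  have hS : ∀ n : ℕ, n < 2 → V (-(2 * q) - 1 - n) = η n := fun n hn => by
    rw [hVW _ (by omega) (by omega), betaSeq_left]
  have hblock : -(2 * q) ≤ j ∧ j ≤ 2 * p := by
    by_contra hc
    refine hVj ?_
    rw [hVW j hj hj', betaSeq]
    split_ifs
    exacts [(hη _).2, absurd ⟨by omega, by omega⟩ hc, absurd ⟨by omega, by omega⟩ hc, (hθ _).2]
  have hjev : Even j := by
    by_contra hc
    refine hVj ?_
    rw [hB j hblock.1 hblock.2, if_neg hc]
    omega
  obtain ⟨i, rfl⟩ := even_iff_two_dvd.1 hjev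
  have e0 := lamCF_block hV hB (i := 0) (a := p) (b := q) (by simp) (by simp)
  rw [mul_zero] at e0
  have dT : Digits k fun n : ℕ => V (2 * p + 1 + n) := Digits.right hV _
  have dS : Digits k fun n : ℕ => V (-(2 * q) - 1 - n) := Digits.left hV _
  have hF : 1 / (1 + 1 / (((k - 1 : ℕ) : ℝ) + 1)) = betaMap k 0 := by
    rw [betaMap, Nat.cast_sub (by omega)]
    simp
  have T1 := cfVal_le_of_two_digits dT (c := k - 1) (by
    have := hT 1 (by norm_num)
    rw [this]; exact (hθ 1).2)
  have S1 := cfVal_le_of_two_digits dS (c := k - 1) (by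
    have := hS 1 (by norm_num)
    rw [this]; exact (hη 1).2)
  rw [hF] at T1 S1
  have hTS : p = q + 1 →
      (cfVal fun n => V (2 * p + 1 + n)) ≤ cfVal fun n => V (-(2 * q) - 1 - n) := by
    intro h
    obtain ⟨-, h1, h2, h3⟩ := hpq.resolve_left (by omega)
    have t0 := hT 0 (by norm_num)
    have t1 := hT 1 (by norm_num)
    have s0 := hS 0 (by norm_num)
    have s1 := hS 1 (by norm_num)
    exact cfVal_le_cfVal_of_ne hk dT dS (t1.trans_le (hθ 1).2) (by rw [t0, t1]; exact h1)
      (s0.trans h2) (s1.trans h3)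
  have hk1 : 1 ≤ k := by omega
  rcases le_or_gt i 0 with hi | hi
  · obtain ⟨n, rfl⟩ : ∃ n : ℕ, i = -n := ⟨i.natAbs, by omega⟩
    obtain ⟨b, rfl⟩ : ∃ b, q = b + n := ⟨q - n, by omega⟩
    rw [e0, lamCF_block hV hB (a := p + n) (b := b) (by push_cast; ring) (by push_cast; ring)]
    have := betaMap_iterate_add_le hk1 (cfVal_nonneg dS) (cfVal_nonneg dT) b p n
      (.inr ⟨by omega, S1⟩)
    linarith
  · obtain ⟨n, rfl⟩ : ∃ n : ℕ, i = n := ⟨i.natAbs, by omega⟩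
    obtain ⟨a, rfl⟩ : ∃ a, p = a + n := ⟨p - n, by omega⟩
    rw [e0, lamCF_block hV hB (a := a) (b := q + n) (by push_cast; ring) (by push_cast; ring)]
    have := betaMap_iterate_add_le hk1 (cfVal_nonneg dT) (cfVal_nonneg dS) a q n (by
      by_cases h : a = q
      · exact .inl ⟨h, hTS (by omega)⟩
      · exact .inr ⟨by omega, T1⟩)
    linarith

lemma LSpecK_mono {k l : ℕ} (h : k ≤ l) : LSpecK k ⊆ LSpecK l := fun _ ⟨θ, hθ, hx⟩ =>
  ⟨θ, fun i => ⟨(hθ i).1, (hθ i).2.trans h⟩, hx⟩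

lemma cfVal_le_of_le_digit {k d : ℕ} {a : ℕ → ℕ} (h : Digits k a) (hd : 1 ≤ d) (ha : d ≤ a 0) :
    cfVal a ≤ 1 / (d + 1 / (k + 1)) := by
  have hd' : (1 : ℝ) ≤ d := by exact_mod_cast hd
  have ha' : (d : ℝ) ≤ a 0 := by exact_mod_cast ha
  rw [cfVal_eq h]
  exact one_div_le_one_div_of_le (by positivity) (add_le_add ha' (le_cfVal' h.tail))

/-- A digit `n ≥ 4` between two sequences of `Seq14` gives an element of the Lagrange spectrum as
soon as it beats the values at the digits `4` of these sequences. -/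
lemma add_cfVal_mem_LSpecK {n k : ℕ} (hn : 4 ≤ n) (hnk : n ≤ k) {θ η : ℕ → ℕ} (hθ : θ ∈ Seq14)
    (hη : η ∈ Seq14)
    (hx : 4 + 1 / (((1 : ℕ) : ℝ) + 1 / (k + 1)) + 1 / (((2 : ℕ) : ℝ) + 1 / (k + 1)) ≤
      n + cfVal θ + cfVal η) :
    n + cfVal θ + cfVal η ∈ LSpecK k := by
  have e : lamCF (betaSeq n 0 0 θ η) 0 = n + cfVal θ + cfVal η := by
    rw [lamCF_betaSeq]
    simp [betaW, app_nil]
  rw [← e] at hx ⊢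
  have hc : (5 : ℝ) ≤
      4 + 1 / (((1 : ℕ) : ℝ) + 1 / (k + 1)) + 1 / (((2 : ℕ) : ℝ) + 1 / (k + 1)) := by
    have hk : (4 : ℝ) ≤ k := by exact_mod_cast hn.trans hnk
    have h0 : 1 / ((k : ℝ) + 1) ≤ 1 / (4 + 1) := one_div_le_one_div_of_le
        (by norm_num) (by linarith)
    have h1 := one_div_le_one_div_of_le (by positivity)
      (add_le_add_right h0 ((1 : ℕ) : ℝ))
    have h2 := one_div_le_one_div_of_le (by positivity)
      (add_le_add_right h0 ((2 : ℕ) : ℝ))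
    norm_num at h1 h2 ⊢
    linarith
  refine lamCF_zero_mem_LSpecK (betaSeq_digits ⟨by omega, hnk⟩ (hθ.1.mono (by omega))
    (hη.1.mono (by omega))) 1 fun m hm V hV hVW j hj hj' hj0 => le_max_of_le_left ?_
  refine le_trans ?_ hx
  have hW0 : betaSeq n 0 0 θ η 0 = n := by
    rw [betaSeq_block (by omega) (by omega)]
    simp
  have hWr : ∀ i : ℕ, betaSeq n 0 0 θ η (1 + i) = θ i := fun i => by
    simpa using betaSeq_right (k := n) (p := 0) (q := 0) (θ := θ) (η := η) i
  have hWl : ∀ i : ℕ, betaSeq n 0 0 θ η (-1 - i) = η i := fun i => by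
    simpa using betaSeq_left (k := n) (p := 0) (q := 0) (θ := θ) (η := η) i
  by_cases h3 : V j ≤ 3
  · have : (V j : ℝ) ≤ 3 := by exact_mod_cast h3
    linarith [lamCF_le hV j]
  have dr := Digits.right hV j
  have dl := Digits.left hV j
  rcases lt_or_gt_of_ne hj0 with h | h
  · obtain ⟨i, rfl⟩ : ∃ i : ℕ, j = -1 - i := ⟨(-1 - j).toNat, by omega⟩
    have h4 : V (-1 - i) = 4 := by
      have := hVW _ hj hj'
      rw [hWl] at this
      have := (hη.1 i).2
      omega
    have hin : 2 ≤ V (-1 - i + 1 + (0 : ℕ)) := by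
      rw [hVW _ (by omega) (by omega)]
      cases i with
      | zero => simp [hW0]; omega
      | succ i =>
        rw [hVW _ hj hj', hWl] at h4
        have h1 := (hη.1 i).1
        have h2 : η i ≠ 1 := fun hc => hη.2 i hc h4
        have e1 : (-1 - ((i + 1 : ℕ) : ℤ) + 1 + (0 : ℕ)) = -1 - i := by push_cast; ring
        rw [e1, hWl]
        omega
    have b1 := cfVal_le_of_le_digit dr (d := 2) (by norm_num) hin
    have b2 := cfVal_le_of_le_digit dl (d := 1) le_rfl (hV _).1
    rw [lamCF, h4]
    push_cast at b1 b2 ⊢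
    linarith
  · obtain ⟨i, rfl⟩ : ∃ i : ℕ, j = 1 + i := ⟨(j - 1).toNat, by omega⟩
    have h4 : V (1 + i) = 4 := by
      have := hVW _ hj hj'
      rw [hWr] at this
      have := (hθ.1 i).2
      omega
    have hin : 2 ≤ V (1 + i - 1 - (0 : ℕ)) := by
      rw [hVW _ (by omega) (by omega)]
      cases i with
      | zero => simp [hW0]; omega
      | succ i =>
        rw [hVW _ hj hj', hWr] at h4
        have h1 := (hθ.1 i).1
        have h2 : θ i ≠ 1 := fun hc => hθ.2 i hc h4
        have e1 : (1 + ((i + 1 : ℕ) : ℤ) - 1 - (0 : ℕ)) = 1 + i := by push_cast; ring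
        rw [e1, hWr]
        omega
    have b1 := cfVal_le_of_le_digit dl (d := 2) (by norm_num) hin
    have b2 := cfVal_le_of_le_digit dr (d := 1) le_rfl (hV _).1
    rw [lamCF, h4]
    push_cast at b1 b2 ⊢
    linarith

lemma mem_LSpecK_of_le_of_lt {k : ℕ} (hk : 5 ≤ k) {x : ℝ} (hx : 5.4 ≤ x) (hxk : x < k + 1) :
    x ∈ LSpecK k := by
  set n := ⌊x - 1 / 2⌋₊
  have h1 : (n : ℝ) ≤ x - 1 / 2 := Nat.floor_le (by linarith)
  have h2 : x - 1 / 2 < n + 1 := Nat.lt_floor_add_one _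
  have hn4 : 4 ≤ n := Nat.le_floor (by norm_num; linarith)
  have hnk : n ≤ k := by
    have : (n : ℝ) < k + 1 := by linarith
    exact Nat.lt_succ_iff.1 (by exact_mod_cast this)
  obtain ⟨_, ⟨θ, hθ, rfl⟩, _, ⟨η, hη, rfl⟩, hsum⟩ :=
    mem_E14_add_E14 (t := x - n) (by linarith) (by linarith)
  have hxe : x = n + cfVal θ + cfVal η := by
    simp only at hsum
    linarith
  rcases hn4.eq_or_lt with h4 | h5
  · refine LSpecK_mono (by omega : 4 ≤ k) ?_
    rw [hxe]
    refine add_cfVal_mem_LSpecK hn4 h4.ge hθ hη ?_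
    rw [← hxe]
    norm_num at hx ⊢
    linarith
  · rw [hxe]
    refine add_cfVal_mem_LSpecK hn4 hnk hθ hη ?_
    rw [← hxe]
    have h5' : (5 : ℝ) ≤ n := by exact_mod_cast h5
    have hk0 : 0 ≤ 1 / ((k : ℝ) + 1) := by positivity
    have b1 := one_div_le_one_div_of_le (by norm_num)
      (by linarith : (1 : ℝ) ≤ 1 + 1 / ((k : ℝ) + 1))
    have b2 := one_div_le_one_div_of_le (by norm_num)
      (by linarith : (2 : ℝ) ≤ 2 + 1 / ((k : ℝ) + 1))
    push_cast
    linarith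

/-- For every integer `k ≥ 5` and every `s ≥ 1`, both
`k + C̃_k(β^s) + C_k(γ^s) ⊆ L(k)` and `k + C_k(β^s) + C_k(β^s) ⊆ L(k)`; moreover,
for `s = 0` (`β^0` the empty word), `k + C_k(β^0) + C_k(β^0) ⊆ L(k)`. -/
theorem sums_in_lagrange_k (k : ℕ) (hk : 5 ≤ k) :
    (∀ s : ℕ, 1 ≤ s →
      {(k : ℝ)} + Ctilk k (betaW k s) + Ck k (gammaW k s) ⊆ LSpecK k ∧
      {(k : ℝ)} + Ck k (betaW k s) + Ck k (betaW k s) ⊆ LSpecK k) ∧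
    {(k : ℝ)} + Ck k (betaW k 0) + Ck k (betaW k 0) ⊆ LSpecK k := by
  have digits_app : ∀ (p : ℕ) {θ : ℕ → ℕ}, Digits (k - 1) θ → Digits k (app (betaW k p) θ) := by
    intro p θ hθ n
    have := hθ (n - 2 * p)
    rw [app_betaW]
    split_ifs <;> omega
  have half_le : ∀ {a : ℕ → ℕ}, Digits k a → a 0 = 1 → 1 / 2 ≤ cfVal a := by
    intro a ha h0
    have := le_cfVal ha
    rw [h0] at this
    norm_num at this ⊢
    exact this
  have app_zero : ∀ (p : ℕ) (θ : ℕ → ℕ), (p = 0 → θ 0 = 1) → app (betaW k p) θ 0 = 1 := by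
    intro p θ h
    rw [app_betaW]
    split_ifs with h1 h2
    · rfl
    · simp at h2
    · simpa using h (by omega)
  refine ⟨fun s hs => ⟨?_, ?_⟩, ?_⟩
  · rintro _ ⟨_, ⟨_, rfl, _, ⟨θ, hθ, hne, rfl⟩, rfl⟩, _, ⟨η, hη, rfl⟩, rfl⟩
    have hη' : Digits (k - 1) (app [1, k - 1] η) := by
      intro n
      match n with
      | 0 => simp only [app_cons_zero]; omega
      | 1 => simp only [app_cons_succ, app_cons_zero]; omega
      | n + 2 => simpa only [app_cons_succ, app_nil] using hη n
    simp only [gammaW, app_append]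
    refine add_cfVal_app_betaW_mem_LSpecK (by omega) hθ hη' ?_
      (.inr ⟨by omega, hne, by simp [app_cons_zero], by simp [app_cons_succ, app_cons_zero]⟩)
    linarith [half_le (digits_app s hθ) (app_zero s θ (by omega)),
      half_le (digits_app (s - 1) hη') (app_zero (s - 1) _ fun _ => by simp [app_cons_zero])]
  · rintro _ ⟨_, ⟨_, rfl, _, ⟨θ, hθ, rfl⟩, rfl⟩, _, ⟨η, hη, rfl⟩, rfl⟩
    refine add_cfVal_app_betaW_mem_LSpecK (by omega) hθ hη ?_ (.inl rfl)
    linarith [half_le (digits_app s hθ) (app_zero s θ (by omega)),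
      half_le (digits_app s hη) (app_zero s η (by omega))]
  · rintro _ ⟨_, ⟨_, rfl, _, ⟨θ, hθ, rfl⟩, rfl⟩, _, ⟨η, hη, rfl⟩, rfl⟩
    by_cases hx : 1 ≤ cfVal (app (betaW k 0) θ) + cfVal (app (betaW k 0) η)
    · exact add_cfVal_app_betaW_mem_LSpecK (by omega) hθ hη hx (.inl rfl)
    have e : ∀ θ : ℕ → ℕ, app (betaW k 0) θ = θ := fun θ => by simp [betaW, app_nil]
    simp only [e] at hx ⊢
    push Not at hx
    refine mem_LSpecK_of_le_of_lt hk ?_ (by linarith)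
    have h1 := le_cfVal' (k := k - 1) hθ
    have h2 := le_cfVal' (k := k - 1) hη
    rw [Nat.cast_sub (by omega), Nat.cast_one, sub_add_cancel] at h1 h2
    rcases hk.eq_or_lt with rfl | h6
    · norm_num at h1 h2 ⊢
      linarith
    · have h6' : (6 : ℝ) ≤ k := by exact_mod_cast h6
      have : 0 ≤ 1 / (k : ℝ) := by positivity
      linarith
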